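/- arXiv:math-ph/0303047 — 2 statements merged into one kernel-verified Lean document; each statement's English description precedes it below -/
import Mathlib

section
/- For every real number y with −1 ≤ y ≤ 1, the improper integral ∫_{−1}^{1} ln((x−y)²)/√(1−x²) dx equals −2π·ln 2; equivalently, (1/(2π))·∫_{−1}^{1} ln((x−y)²)/√(1−x²) dx + ln 2 = 0. -/
open MeasureTheory Real

open Polynomial in
lemma logMahlerMeasure_half_mul_quadratic (y : ℝ) (hy : -1 ≤ y) (hy' : y ≤ 1) :
    (C (1 / 2 : ℂ) * (X ^ 2 - C (2 * y : ℂ) * X + 1)).logMahlerMeasure = -Real.log 2 := by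
  have hfactor : (X ^ 2 - C (2 * y : ℂ) * X + 1)
      = (X - C (circleMap 0 1 (arccos y))) * (X - C (circleMap 0 1 (-arccos y))) := by
    have hsum : (2 * y : ℂ) = circleMap 0 1 (arccos y) + circleMap 0 1 (-arccos y) := by
      conv_lhs => rw [← cos_arccos hy hy']
      simp [circleMap, Complex.two_cos]
    have hprod : (1 : ℂ) = circleMap 0 1 (arccos y) * circleMap 0 1 (-arccos y) := by
      simp [circleMap, ← Complex.exp_add]
    have hprod' := congrArg C hprod
    rw [C_mul, C_1] at hprod'
    rw [hsum, C_add]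
    linear_combination hprod'
  rw [hfactor, logMahlerMeasure_mul_eq_add_logMahlerMeasure
      (mul_ne_zero (by simp) (mul_ne_zero (X_sub_C_ne_zero _) (X_sub_C_ne_zero _))),
    logMahlerMeasure_mul_eq_add_logMahlerMeasure
      (mul_ne_zero (X_sub_C_ne_zero _) (X_sub_C_ne_zero _))]
  simp [posLog]

lemma norm_half_mul_quadratic_circleMap (y θ : ℝ) :
    ‖(1 / 2 : ℂ) * (circleMap 0 1 θ ^ 2 - 2 * y * circleMap 0 1 θ + 1)‖ = |cos θ - y| := by
  have h : (1 / 2 : ℂ) * (circleMap 0 1 θ ^ 2 - 2 * y * circleMap 0 1 θ + 1)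
      = circleMap 0 1 θ * ((cos θ - y : ℝ) : ℂ) := by
    have hinv : circleMap 0 1 θ * Complex.exp (-θ * Complex.I) = 1 := by
      simp [circleMap, ← Complex.exp_add]
    have hcos : (2 * cos θ : ℂ) = circleMap 0 1 θ + Complex.exp (-θ * Complex.I) := by
      simp [circleMap, Complex.two_cos]
    push_cast at hcos ⊢
    linear_combination (-1 / 2) * hinv - circleMap 0 1 θ / 2 * hcos
  rw [h, norm_mul, norm_circleMap_zero, Complex.norm_real, abs_one, one_mul, norm_eq_abs]

lemma integral_log_cos_sub_zero_two_pi (y : ℝ) (hy : -1 ≤ y) (hy' : y ≤ 1) :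
    ∫ θ in 0..2 * π, log (cos θ - y) = -(2 * π * log 2) := by
  have h := logMahlerMeasure_half_mul_quadratic y hy hy'
  rw [Polynomial.logMahlerMeasure_def, circleAverage_def] at h
  have heval (θ : ℝ) : log ‖(Polynomial.C (1 / 2 : ℂ) * (Polynomial.X ^ 2
      - Polynomial.C (2 * y : ℂ) * Polynomial.X + 1)).eval (circleMap 0 1 θ)‖
      = log (cos θ - y) := by
    rw [← log_abs (cos θ - y), ← norm_half_mul_quadratic_circleMap]
    simp only [Polynomial.eval_mul, Polynomial.eval_add, Polynomial.eval_sub, Polynomial.eval_pow,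
      Polynomial.eval_C, Polynomial.eval_X, Polynomial.eval_one]
  simp only [heval, smul_eq_mul] at h
  rw [inv_mul_eq_iff_eq_mul₀ (by positivity)] at h
  rw [h]
  ring

lemma intervalIntegrable_log_cos_sub (y a b : ℝ) :
    IntervalIntegrable (fun θ ↦ log (cos θ - y)) volume a b :=
  MeromorphicOn.intervalIntegrable_log (f := fun θ ↦ cos θ - y)
    (analyticOnNhd_cos.sub analyticOnNhd_const).meromorphicOn

lemma integral_log_cos_sub_sq_zero_pi (y : ℝ) (hy : -1 ≤ y) (hy' : y ≤ 1) :
    ∫ θ in 0..π, log ((cos θ - y) ^ 2) = -(2 * π * log 2) := by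
  have hreflect : ∫ θ in π..2 * π, log (cos θ - y) = ∫ θ in 0..π, log (cos θ - y) := by
    have h := intervalIntegral.integral_comp_sub_left (a := 0) (b := π)
      (fun θ ↦ log (cos θ - y)) (2 * π)
    simp only [cos_two_pi_sub, sub_zero, show 2 * π - π = π by ring] at h
    exact h.symm
  rw [← integral_log_cos_sub_zero_two_pi y hy hy',
    ← intervalIntegral.integral_add_adjacent_intervals
      (intervalIntegrable_log_cos_sub y 0 π) (intervalIntegrable_log_cos_sub y π (2 * π)),
    hreflect]
  simp only [log_pow, intervalIntegral.integral_const_mul]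
  push_cast
  ring

/-- For every `y ∈ [−1,1]`, `∫_{−1}^{1} ln((x−y)²)/√(1−x²) dx = −2π ln 2`;
equivalently `(1/(2π)) ∫_{−1}^{1} ln((x−y)²)/√(1−x²) dx + ln 2 = 0`. -/
theorem log_integral_eq_neg_two_pi_log_two (y : ℝ) (hy : -1 ≤ y) (hy' : y ≤ 1) :
    (∫ x in Set.Ioo (-1 : ℝ) 1, Real.log ((x - y) ^ 2) / Real.sqrt (1 - x ^ 2))
      = -(2 * Real.pi * Real.log 2) ∧
    (1 / (2 * Real.pi)) *
        (∫ x in Set.Ioo (-1 : ℝ) 1, Real.log ((x - y) ^ 2) / Real.sqrt (1 - x ^ 2))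
      + Real.log 2 = 0 := by
  have h : (∫ x in Set.Ioo (-1 : ℝ) 1, Real.log ((x - y) ^ 2) / Real.sqrt (1 - x ^ 2))
      = -(2 * Real.pi * Real.log 2) := by
    rw [← integral_log_cos_sub_sq_zero_pi y hy hy',
      ← Polynomial.Chebyshev.integral_measureT_eq_integral_cos (f := fun x ↦ log ((x - y) ^ 2)),
      Polynomial.Chebyshev.integral_measureT, intervalIntegral.integral_of_le (by norm_num),
      integral_Ioc_eq_integral_Ioo]
    simp only [sqrt_inv, div_eq_mul_inv]
  refine ⟨h, ?_⟩
  rw [h]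
  field_simp
  ring
end

section
/- Let r, t ∈ (0,1) with r² + t² = 1, and let S_{n−1}(0) be the weighted number of closed paths of n steps from 0 to 0, i.e. the sum over all paths (k₀ = 0, k₁, …, k_n = 0) ∈ ℤ^{n+1} of ∏_{m=0}^{n−1} w(k_m, k_{m+1} − k_m), where w(k,d) = r² if d = 0, w(k,d) = rt if |d| = 1, w(k,d) = t² if (d = 2 and k odd) or (d = −2 and k even), and w(k,d) = 0 otherwise. Then there exists a constant c > 0 such that S_{n−1}(0)·√n/(r+t)^{2n} converges to c as n → ∞; equivalently S_{n−1}(0) = c·(r+t)^{2n}/√n·(1 + o(1)). -/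
open Classical in
/-- The weight of a step `d` taken from position `k`: `r²` for staying, `rt` for a nearest
neighbour step, `t²` for the allowed next-nearest neighbour step (`+2` from odd sites,
`−2` from even sites), `0` otherwise. -/
noncomputable def stepWeight (r t : ℝ) (k d : ℤ) : ℝ :=
  if d = 0 then r ^ 2
  else if d = 1 ∨ d = -1 then r * t
  else if (d = 2 ∧ Odd k) ∨ (d = -2 ∧ Even k) then t ^ 2
  else 0

/-- `S_{n−1}(j)`: the sum over all paths `(k₀ = 0, k₁, …, k_n = j)` in `ℤ` of the product of
the step weights (a finite sum: only finitely many paths carry nonzero weight). -/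
noncomputable def pathSum (r t : ℝ) (n : ℕ) (j : ℤ) : ℝ :=
  ∑ᶠ p ∈ {p : Fin (n + 1) → ℤ | p 0 = 0 ∧ p (Fin.last n) = j},
    ∏ m : Fin n, stepWeight r t (p m.castSucc) (p m.succ - p m.castSucc)

theorem stepWeight_eq_zero_of_two_lt {r t : ℝ} {k d : ℤ} (h : 2 < |d|) :
    stepWeight r t k d = 0 := by
  have h' : 2 < d ∨ 2 < -d := lt_abs.mp h
  unfold stepWeight
  rw [if_neg (by omega), if_neg (by omega), if_neg (by omega)]

/-- Only finitely many paths issued from `0` carry a nonzero weight. -/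
theorem finite_paths (r t : ℝ) (n : ℕ) :
    {p : Fin (n + 1) → ℤ | p 0 = 0 ∧
      ∏ m : Fin n, stepWeight r t (p m.castSucc) (p m.succ - p m.castSucc) ≠ 0}.Finite := by
  refine (Set.Finite.pi' (t := fun i : Fin (n + 1) => Set.Icc (-(2 * (i : ℤ))) (2 * (i : ℤ)))
    fun i => Set.finite_Icc _ _).subset ?_
  rintro p ⟨h0, hp⟩ i
  induction i using Fin.induction with
  | zero => simp [h0]
  | succ m ih =>
    have hm : |p m.succ - p m.castSucc| ≤ 2 := by
      by_contra! h
      exact Finset.prod_ne_zero_iff.mp hp m (Finset.mem_univ _) (stepWeight_eq_zero_of_two_lt h)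
    rw [abs_le] at hm
    simp only [Set.mem_Icc, Fin.val_castSucc, Fin.val_succ] at ih ⊢
    push_cast
    constructor <;> linarith [ih.1, ih.2, hm.1, hm.2]

theorem pathSum_eq_sum (r t : ℝ) (n : ℕ) (j : ℤ) :
    pathSum r t n j = ∑ p ∈ (finite_paths r t n).toFinset with p (Fin.last n) = j,
      ∏ m : Fin n, stepWeight r t (p m.castSucc) (p m.succ - p m.castSucc) := by
  refine finsum_mem_eq_sum_of_inter_support_eq _ ?_
  ext p
  simp only [Set.mem_inter_iff, Set.mem_ofPred_eq, Function.mem_support, Finset.coe_filter,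
    Set.Finite.mem_toFinset]
  tauto

theorem pathSum_zero (r t : ℝ) (j : ℤ) : pathSum r t 0 j = if j = 0 then 1 else 0 := by
  unfold pathSum
  split_ifs with hj
  · have : {p : Fin (0 + 1) → ℤ | p 0 = 0 ∧ p (Fin.last 0) = j} = {fun _ => 0} := by
      ext p
      simp only [Set.mem_ofPred_eq, Set.mem_singleton_iff, funext_iff, hj]
      exact ⟨fun h i => by rw [Fin.fin_one_eq_zero i]; exact h.1, fun h => ⟨h _, h _⟩⟩
    rw [this, finsum_mem_singleton]
    simp
  · have : {p : Fin (0 + 1) → ℤ | p 0 = 0 ∧ p (Fin.last 0) = j} = ∅ := by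
      ext p
      simp only [Set.mem_ofPred_eq, Set.mem_empty_iff_false, iff_false]
      rintro ⟨h0, h1⟩
      exact hj (h1.symm.trans h0)
    rw [this, finsum_mem_empty]

theorem pathSum_succ (r t : ℝ) (n : ℕ) (j : ℤ) :
    pathSum r t (n + 1) j =
      ∑ k ∈ Finset.Icc (j - 2) (j + 2), pathSum r t n k * stepWeight r t k (j - k) := by
  have h1 : pathSum r t (n + 1) j = ∑ᶠ p ∈ {p : Fin (n + 1) → ℤ | p 0 = 0},
      (∏ m : Fin n, stepWeight r t (p m.castSucc) (p m.succ - p m.castSucc)) *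
        stepWeight r t (p (Fin.last n)) (j - p (Fin.last n)) := by
    refine finsum_mem_eq_of_bijOn (fun p => Fin.init p) ⟨?_, ?_, ?_⟩ ?_
    · rintro p ⟨h0, -⟩
      exact h0
    · rintro p ⟨-, hp⟩ q ⟨-, hq⟩ h
      rw [← Fin.snoc_init_self p, ← Fin.snoc_init_self q, hp, hq]
      exact congrArg (fun f => Fin.snoc (α := fun _ => ℤ) f j) h
    · intro p hp
      refine ⟨Fin.snoc (α := fun _ => ℤ) p j, ⟨?_, by simp⟩, by simp⟩
      have : (0 : Fin (n + 1 + 1)) = Fin.castSucc 0 := rfl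
      rw [this, Fin.snoc_castSucc]
      exact hp
    · rintro p ⟨-, hp⟩
      rw [Fin.prod_univ_castSucc, Fin.succ_last, hp]
      rfl
  have h2 : pathSum r t (n + 1) j = ∑ p ∈ (finite_paths r t n).toFinset,
      (∏ m : Fin n, stepWeight r t (p m.castSucc) (p m.succ - p m.castSucc)) *
        stepWeight r t (p (Fin.last n)) (j - p (Fin.last n)) := by
    rw [h1]
    refine finsum_mem_eq_sum_of_inter_support_eq _ ?_
    ext p
    simp only [Set.mem_inter_iff, Set.mem_ofPred_eq, Function.mem_support,
      Set.Finite.coe_toFinset, mul_ne_zero_iff]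
    tauto
  rw [h2]
  simp only [pathSum_eq_sum, Finset.sum_mul, Finset.sum_filter]
  rw [Finset.sum_comm]
  refine Finset.sum_congr rfl fun p _ => ?_
  simp only [ite_mul, zero_mul]
  rw [Finset.sum_ite_eq]
  split_ifs with h
  · rfl
  · rw [stepWeight_eq_zero_of_two_lt, mul_zero]
    rw [Finset.mem_Icc] at h
    rw [lt_abs]
    omega

/-- A full step is made of two half steps, each of which either moves on in the current direction
(weight `t`) or stays and reverses the direction (weight `r`). The walk starts at `0` leftwards;
`phaseWeight r t m b` lists the total weights of the histories of `m` half steps, `b` of which were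
made while heading right, that end heading left and right respectively. -/
noncomputable def phaseWeight (r t : ℝ) : ℕ → ℤ → ℝ × ℝ
  | 0, b => (if b = 0 then 1 else 0, 0)
  | m + 1, b =>
    (t * (phaseWeight r t m b).1 + r * (phaseWeight r t m (b - 1)).2,
      r * (phaseWeight r t m b).1 + t * (phaseWeight r t m (b - 1)).2)

theorem pathSum_eq_phaseWeight (r t : ℝ) (n : ℕ) (y : ℤ) :
    pathSum r t n (2 * y) = (phaseWeight r t (2 * n) (n + y)).1 ∧
      pathSum r t n (2 * y + 1) = (phaseWeight r t (2 * n) (n + y)).2 := by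
  induction n generalizing y with
  | zero =>
    simp only [pathSum_zero, phaseWeight, Nat.cast_zero, zero_add]
    refine ⟨by simp, if_neg (by omega)⟩
  | succ n ih =>
    have hIcc (j : ℤ) : Finset.Icc (j - 2) (j + 2) = {j - 2, j - 1, j, j + 1, j + 2} := by
      ext; simp only [Finset.mem_Icc, Finset.mem_insert, Finset.mem_singleton]; omega
    have hsum (j : ℤ) (f : ℤ → ℝ) : ∑ k ∈ Finset.Icc (j - 2) (j + 2), f k =
        f (j - 2) + f (j - 1) + f j + f (j + 1) + f (j + 2) := by
      rw [hIcc, Finset.sum_insert, Finset.sum_insert, Finset.sum_insert, Finset.sum_insert,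
        Finset.sum_singleton]
      · ring
      all_goals simp only [Finset.mem_insert, Finset.mem_singleton]; omega
    have e0 := ih (y - 1)
    have e1 := ih y
    have e2 := ih (y + 1)
    rw [show 2 * (y - 1) = 2 * y - 2 by ring, show 2 * y - 2 + 1 = 2 * y - 1 by ring] at e0
    rw [show 2 * (y + 1) = 2 * y + 2 by ring, show 2 * y + 2 + 1 = 2 * y + 3 by ring] at e2
    have b1 : ((n + 1 : ℕ) : ℤ) + y = n + (y + 1) := by push_cast; ring
    have b2 : (n : ℤ) + (y + 1) - 1 = n + y := by ring
    have b3 : (n : ℤ) + y - 1 = n + (y - 1) := by ring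
    have hev : ¬ Odd (y * 2) := by simp
    simp only [pathSum_succ, hsum, show 2 * (n + 1) = 2 * n + 1 + 1 by ring, phaseWeight, b1, b2,
      b3, ← e0.2, ← e1.1, ← e1.2, ← e2.1]
    constructor
    · simp [stepWeight, parity_simps]
      ring_nf
      simp [hev]
    · simp [stepWeight, parity_simps]
      ring_nf
      simp [hev]

theorem phaseWeight_neg (r t : ℝ) (m : ℕ) {b : ℤ} (hb : b < 0) : phaseWeight r t m b = 0 := by
  induction m generalizing b with
  | zero => simp [phaseWeight, hb.ne]
  | succ m ih => simp [phaseWeight, ih hb, ih (show b - 1 < 0 by omega)]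

theorem phaseWeight_gt (r t : ℝ) (m : ℕ) :
    (∀ b : ℤ, m < b → (phaseWeight r t m b).1 = 0) ∧
      ∀ b : ℤ, m ≤ b → (phaseWeight r t m b).2 = 0 := by
  induction m with
  | zero =>
    refine ⟨fun b hb => if_neg ?_, fun b _ => rfl⟩
    push_cast at hb
    omega
  | succ m ih =>
    push_cast
    refine ⟨fun b hb => ?_, fun b hb => ?_⟩ <;>
    simp [phaseWeight, ih.1 b (by omega), ih.2 (b - 1) (by omega)]

/-- The integral over one period of `Re (zᵏ (t + r z)ᵇ (t + r z⁻¹)ᵃ)`, where `z = exp (i θ)`. -/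
noncomputable def phaseIntegral (r t : ℝ) (k b a : ℕ) : ℝ :=
  ∫ θ in -Real.pi..Real.pi, (Complex.exp (θ * Complex.I) ^ k *
    (t + r * Complex.exp (θ * Complex.I)) ^ b * (t + r * Complex.exp (-(θ * Complex.I))) ^ a).re

theorem phaseIntegral_succ_right (r t : ℝ) (k b a : ℕ) :
    phaseIntegral r t (k + 1) b (a + 1) =
      t * phaseIntegral r t (k + 1) b a + r * phaseIntegral r t k b a := by
  unfold phaseIntegral
  rw [← intervalIntegral.integral_const_mul, ← intervalIntegral.integral_const_mul,
    ← intervalIntegral.integral_add]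
  · refine intervalIntegral.integral_congr fun θ _ => ?_
    simp only [← Complex.re_ofReal_mul, ← Complex.add_re]
    congr 1
    have h : Complex.exp (θ * Complex.I) * Complex.exp (-(θ * Complex.I)) = 1 := by
      rw [← Complex.exp_add, add_neg_cancel, Complex.exp_zero]
    linear_combination (r * Complex.exp (θ * Complex.I) ^ k *
      (t + r * Complex.exp (θ * Complex.I)) ^ b *
      (t + r * Complex.exp (-(θ * Complex.I))) ^ a) * h
  · exact Continuous.intervalIntegrable (by fun_prop) _ _
  · exact Continuous.intervalIntegrable (by fun_prop) _ _

theorem phaseIntegral_succ_left (r t : ℝ) (k b a : ℕ) :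
    phaseIntegral r t k (b + 1) a =
      t * phaseIntegral r t k b a + r * phaseIntegral r t (k + 1) b a := by
  unfold phaseIntegral
  rw [← intervalIntegral.integral_const_mul, ← intervalIntegral.integral_const_mul,
    ← intervalIntegral.integral_add]
  · refine intervalIntegral.integral_congr fun θ _ => ?_
    simp only [← Complex.re_ofReal_mul, ← Complex.add_re]
    congr 1
    ring
  · exact Continuous.intervalIntegrable (by fun_prop) _ _
  · exact Continuous.intervalIntegrable (by fun_prop) _ _

theorem phaseIntegral_succ_zero (r t : ℝ) (k b : ℕ) : phaseIntegral r t (k + 1) b 0 = 0 := by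
  induction b generalizing k with
  | zero =>
    have h (θ : ℝ) : Complex.exp (θ * Complex.I) ^ (k + 1) =
        Complex.exp (((k + 1) * θ : ℝ) * Complex.I) := by
      rw [← Complex.exp_nat_mul]
      push_cast
      ring_nf
    have hk : (k + 1 : ℝ) ≠ 0 := by positivity
    simp only [phaseIntegral, pow_zero, mul_one, h, Complex.exp_ofReal_mul_I_re]
    rw [intervalIntegral.integral_comp_mul_left (fun x => Real.cos x) hk, integral_cos,
      mul_neg, Real.sin_neg]
    have := Real.sin_nat_mul_pi (k + 1)
    push_cast at this
    simp [this]
  | succ b ih => rw [phaseIntegral_succ_left, ih, ih, mul_zero, mul_zero, add_zero]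

theorem phaseIntegral_zero_zero (r t : ℝ) (a : ℕ) :
    phaseIntegral r t 0 0 a = 2 * Real.pi * t ^ a := by
  have hconj (a : ℕ) : phaseIntegral r t 0 0 a = phaseIntegral r t 0 a 0 := by
    refine intervalIntegral.integral_congr fun θ _ => ?_
    rw [← Complex.conj_re]
    simp [← Complex.exp_conj]
  rw [hconj]
  induction a with
  | zero =>
    simp [phaseIntegral]
    ring
  | succ a ih =>
    rw [phaseIntegral_succ_left, phaseIntegral_succ_zero, ih]
    ring

theorem phaseWeight_eq_phaseIntegral (r t : ℝ) (m : ℕ) :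
    (∀ a b : ℕ, a + b + 1 = m →
      2 * Real.pi * (phaseWeight r t m (b + 1 : ℕ)).1 = r * phaseIntegral r t 1 b a) ∧
    (∀ a b : ℕ, a + b + 1 = m →
      2 * Real.pi * (phaseWeight r t m b).2 = r * phaseIntegral r t 0 b a) ∧
    (phaseWeight r t m 0).1 = t ^ m := by
  induction m with
  | zero => simp [phaseWeight]
  | succ m ih =>
    obtain ⟨ih1, ih2, ih3⟩ := ih
    refine ⟨fun a b h => ?_, fun a b h => ?_, ?_⟩
    · have hb : ((b + 1 : ℕ) : ℤ) - 1 = b := by push_cast; ring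
      simp only [phaseWeight, hb]
      obtain _ | a := a
      · rw [(phaseWeight_gt r t m).1 _ (by omega), (phaseWeight_gt r t m).2 _ (by omega),
          phaseIntegral_succ_zero]
        ring
      · rw [phaseIntegral_succ_right]
        linear_combination t * ih1 a b (by omega) + r * ih2 a b (by omega)
    · obtain _ | b := b
      · have hm : m = a := by omega
        simp only [phaseWeight, Nat.cast_zero, ih3, Prod.snd_zero,
          phaseWeight_neg r t m (show (0 : ℤ) - 1 < 0 by simp), phaseIntegral_zero_zero, ← hm]
        ring
      · have hb : ((b + 1 : ℕ) : ℤ) - 1 = b := by push_cast; ring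
        simp only [phaseWeight, hb]
        rw [phaseIntegral_succ_left]
        linear_combination r * ih1 a b (by omega) + t * ih2 a b (by omega)
    · simp only [phaseWeight, ih3, phaseWeight_neg r t m (show (0 : ℤ) - 1 < 0 by simp),
        Prod.snd_zero]
      ring

open Filter Topology MeasureTheory Real in
/-- Laplace's method for the powers of `1 - κ (1 - cos θ)` over one period. -/
theorem tendsto_sqrt_mul_integral_pow {κ : ℝ} (hκ : 0 < κ) (hκ' : 2 * κ ≤ 1) {h : ℝ → ℝ}
    (hh : Continuous h) {C : ℝ} (hC : ∀ θ, |h θ| ≤ C) :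
    Tendsto (fun m : ℕ => √m * ∫ θ in -π..π, h θ * (1 - κ * (1 - cos θ)) ^ m) atTop
      (𝓝 (h 0 * √(2 * π / κ))) := by
  have hπ := pi_pos
  have hscale : ∀ᶠ m : ℕ in atTop,
      ∫ u, (Set.Ioc (-(π * √m)) (π * √m)).indicator
        (fun u => h (u / √m) * (1 - κ * (1 - cos (u / √m))) ^ m) u =
      √m * ∫ θ in -π..π, h θ * (1 - κ * (1 - cos θ)) ^ m := by
    filter_upwards [eventually_gt_atTop 0] with m hm
    have hs : (0 : ℝ) < √m := Real.sqrt_pos.mpr (Nat.cast_pos.mpr hm)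
    rw [integral_indicator measurableSet_Ioc, ← intervalIntegral.integral_of_le (by nlinarith),
      intervalIntegral.integral_comp_div (fun x => h x * (1 - κ * (1 - cos x)) ^ m) hs.ne',
      neg_div, mul_div_cancel_right₀ _ hs.ne', smul_eq_mul]
  refine Tendsto.congr' hscale ?_
  have hval : h 0 * √(2 * π / κ) = ∫ u, h 0 * exp (-(κ / 2) * u ^ 2) := by
    rw [integral_const_mul, integral_gaussian]
    congr 2
    field_simp
  rw [hval]
  refine tendsto_integral_of_dominated_convergence
    (fun u => C * exp (-(2 * κ / π ^ 2) * u ^ 2)) (fun m => ?_) ?_ (fun m => ?_) ?_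
  · exact AEStronglyMeasurable.indicator (Continuous.aestronglyMeasurable (by fun_prop))
      measurableSet_Ioc
  · exact (integrable_exp_neg_mul_sq (by positivity)).const_mul _
  · refine Eventually.of_forall fun u => ?_
    have hC0 : 0 ≤ C := (abs_nonneg _).trans (hC 0)
    by_cases hu : u ∈ Set.Ioc (-(π * √m)) (π * √m)
    · rw [Set.indicator_of_mem hu, norm_mul, Real.norm_eq_abs, Real.norm_eq_abs, abs_pow]
      refine mul_le_mul (hC _) ?_ (by positivity) hC0
      have hs : (0 : ℝ) < √m := by
        by_contra! hle
        nlinarith [hu.1, hu.2]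
      have hx : |u / √m| ≤ π := by
        rw [abs_div, abs_of_pos hs, div_le_iff₀ hs, abs_le]
        exact ⟨hu.1.le, hu.2⟩
      have hcos := Real.cos_le_one_sub_mul_cos_sq hx
      have h0 : 0 ≤ 1 - κ * (1 - cos (u / √m)) := by
        nlinarith [Real.neg_one_le_cos (u / √m)]
      have h1 : 1 - κ * (1 - cos (u / √m)) ≤ exp (-(κ * (2 / π ^ 2 * (u / √m) ^ 2))) := by
        refine le_trans ?_ (Real.one_sub_le_exp_neg _)
        nlinarith
      rw [abs_of_nonneg h0]
      refine (pow_le_pow_left₀ h0 h1 m).trans_eq ?_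
      rw [← Real.exp_nat_mul]
      congr 1
      have hm : (√m) ^ 2 = m := Real.sq_sqrt (Nat.cast_nonneg m)
      have hm0 : (m : ℝ) ≠ 0 := by rw [← hm]; positivity
      rw [div_pow, hm]
      field_simp
    · rw [Set.indicator_of_notMem hu, norm_zero]
      positivity
  · refine Eventually.of_forall fun u => ?_
    have hsqrt : Tendsto (fun m : ℕ => √m) atTop atTop :=
      Real.tendsto_sqrt_atTop.comp tendsto_natCast_atTop_atTop
    have hdiv : Tendsto (fun m : ℕ => u / √m) atTop (𝓝 0) := hsqrt.const_div_atTop u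
    have hpow : Tendsto (fun m : ℕ => (1 - κ * (1 - cos (u / √m))) ^ m) atTop
        (𝓝 (exp (-(κ / 2) * u ^ 2))) := by
      simp only [sub_eq_add_neg (1 : ℝ) (κ * _)]
      refine Real.tendsto_one_add_pow_exp_of_tendsto ?_
      have hsinc : Tendsto (fun m : ℕ => -(κ / 2) * u ^ 2 * sinc (u / √m / 2) ^ 2) atTop
          (𝓝 (-(κ / 2) * u ^ 2)) := by
        have := (Real.continuous_sinc.tendsto 0).comp
          (show Tendsto (fun m : ℕ => u / √m / 2) atTop (𝓝 0) by simpa using hdiv.div_const 2)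
        simpa only [Function.comp_def, Real.sinc_zero, one_pow, mul_one] using
          (this.pow 2).const_mul (-(κ / 2) * u ^ 2)
      refine hsinc.congr' ?_
      filter_upwards [eventually_gt_atTop 0] with m hm
      have hm' : (0 : ℝ) < m := Nat.cast_pos.mpr hm
      have hs : (0 : ℝ) < √m := Real.sqrt_pos.mpr hm'
      have hs2 : (√m) ^ 2 = m := Real.sq_sqrt hm'.le
      have hcos : 1 - cos (u / √m) = 2 * sin (u / √m / 2) ^ 2 := by
        rw [Real.sin_sq_eq_half_sub]
        ring_nf
      rw [hcos]
      by_cases hu : u = 0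
      · simp [hu]
      · rw [Real.sinc_of_ne_zero (by positivity)]
        rw [div_pow _ (u / √m / 2), div_pow (u / √m), div_pow u, hs2]
        field_simp
    refine (((hh.tendsto 0).comp hdiv).mul hpow).congr' ?_
    filter_upwards [hsqrt.eventually_gt_atTop (|u| / π)] with m hm
    rw [div_lt_iff₀ hπ, mul_comm, abs_lt] at hm
    rw [Set.indicator_of_mem (Set.mem_Ioc.mpr ⟨hm.1, hm.2.le⟩)]
    rfl

theorem pathSum_succ_zero_eq_integral (r t : ℝ) (m : ℕ) :
    2 * Real.pi * pathSum r t (m + 1) 0 = r * ∫ θ in -Real.pi..Real.pi,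
      (r + t * Real.cos θ) * (r ^ 2 + t ^ 2 + 2 * (r * t) * Real.cos θ) ^ m := by
  have h1 := (pathSum_eq_phaseWeight r t (m + 1) 0).1
  rw [mul_zero, add_zero] at h1
  rw [h1, (phaseWeight_eq_phaseIntegral r t _).1 (m + 1) m (by ring), phaseIntegral]
  congr 1
  refine intervalIntegral.integral_congr fun θ _ => ?_
  have hz : Complex.exp (θ * Complex.I) * Complex.exp (-(θ * Complex.I)) = 1 := by
    rw [← Complex.exp_add, add_neg_cancel, Complex.exp_zero]
  have hcos : Complex.exp (θ * Complex.I) + Complex.exp (-(θ * Complex.I)) =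
      2 * Real.cos θ := by
    rw [Complex.ofReal_cos, Complex.two_cos, neg_mul]
  have hprod : (t + r * Complex.exp (θ * Complex.I)) *
      (t + r * Complex.exp (-(θ * Complex.I))) =
        ((r ^ 2 + t ^ 2 + 2 * (r * t) * Real.cos θ : ℝ) : ℂ) := by
    push_cast [-Complex.ofReal_cos]
    linear_combination r ^ 2 * hz + r * t * hcos
  have hre : (r + t * Complex.exp (θ * Complex.I)).re = r + t * Real.cos θ := by
    rw [Complex.add_re, Complex.re_ofReal_mul, Complex.exp_ofReal_mul_I_re, Complex.ofReal_re]
  have hsplit : Complex.exp (θ * Complex.I) ^ 1 * (t + r * Complex.exp (θ * Complex.I)) ^ m *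
      (t + r * Complex.exp (-(θ * Complex.I))) ^ (m + 1) =
        (((r ^ 2 + t ^ 2 + 2 * (r * t) * Real.cos θ) ^ m : ℝ) : ℂ) *
          (r + t * Complex.exp (θ * Complex.I)) := by
    rw [Complex.ofReal_pow, ← hprod, mul_pow]
    linear_combination (r * (t + r * Complex.exp (θ * Complex.I)) ^ m *
      (t + r * Complex.exp (-(θ * Complex.I))) ^ m) * hz
  simp only [hsplit, Complex.re_ofReal_mul, hre]
  ring

/-- Asymptotics of the weighted number of closed paths: there is a constant `c > 0` with
`S_{n−1}(0) = c·(r+t)^{2n}/√n·(1 + o(1))`, i.e. `S_{n−1}(0)·√n/(r+t)^{2n} → c`. -/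
theorem pathSum_asymptotics (r t : ℝ) (hr : r ∈ Set.Ioo (0 : ℝ) 1)
    (ht : t ∈ Set.Ioo (0 : ℝ) 1) (hrt : r ^ 2 + t ^ 2 = 1) :
    ∃ c > 0, Filter.Tendsto
      (fun n : ℕ => pathSum r t n 0 * Real.sqrt n / (r + t) ^ (2 * n))
      Filter.atTop (nhds c) := by
  have hr0 : 0 < r := hr.1
  have ht0 : 0 < t := ht.1
  have hπ := Real.pi_pos
  set κ : ℝ := 2 * (r * t) / (r + t) ^ 2 with hκ
  have hκ0 : 0 < κ := by positivity
  have hκ1 : 2 * κ ≤ 1 := by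
    rw [hκ, mul_div_assoc', div_le_one (by positivity)]
    nlinarith [sq_nonneg (r - t)]
  have hlim := tendsto_sqrt_mul_integral_pow hκ0 hκ1
    (h := fun θ => r * (r + t * Real.cos θ) / (r + t) ^ 2) (by fun_prop)
    (C := r * (r + t) / (r + t) ^ 2) (fun θ => by
      rw [abs_div, abs_mul, abs_of_pos hr0, abs_of_pos (show 0 < (r + t) ^ 2 by positivity)]
      gcongr
      rw [abs_le]
      constructor <;> nlinarith [Real.neg_one_le_cos θ, Real.cos_le_one θ])
  have hratio : Filter.Tendsto (fun m : ℕ => Real.sqrt (1 + 1 / (m : ℝ))) Filter.atTop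
      (nhds 1) := by
    have := (tendsto_one_div_atTop_nhds_zero_nat (𝕜 := ℝ)).const_add 1
    simpa using this.sqrt
  refine ⟨(2 * Real.pi)⁻¹ * (1 * (r * (r + t * Real.cos 0) / (r + t) ^ 2 *
    Real.sqrt (2 * Real.pi / κ))), ?_, ?_⟩
  · rw [Real.cos_zero]
    positivity
  rw [← Filter.tendsto_add_atTop_iff_nat 1]
  refine ((hratio.mul hlim).const_mul (2 * Real.pi)⁻¹).congr' ?_
  filter_upwards [Filter.eventually_gt_atTop 0] with m hm
  have hm' : (0 : ℝ) < m := Nat.cast_pos.mpr hm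
  have hsqrt : Real.sqrt (1 + 1 / (m : ℝ)) * Real.sqrt m = Real.sqrt ((m + 1 : ℕ) : ℝ) := by
    rw [← Real.sqrt_mul (by positivity)]
    congr 1
    push_cast
    field_simp
  have hint : ∫ θ in -Real.pi..Real.pi, r * (r + t * Real.cos θ) / (r + t) ^ 2 *
      (1 - κ * (1 - Real.cos θ)) ^ m = 2 * Real.pi * pathSum r t (m + 1) 0 /
        (r + t) ^ (2 * (m + 1)) := by
    rw [pathSum_succ_zero_eq_integral, mul_div_right_comm, ← intervalIntegral.integral_const_mul]
    refine intervalIntegral.integral_congr fun θ _ => ?_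
    have hbase : 1 - κ * (1 - Real.cos θ) =
        (r ^ 2 + t ^ 2 + 2 * (r * t) * Real.cos θ) / (r + t) ^ 2 := by
      rw [hκ]
      field_simp
      ring
    simp only [hbase, div_pow, mul_add 2 m 1, pow_add, pow_mul]
    field_simp
  rw [hint, ← hsqrt]
  field_simp
end
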